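/- Let s, s' ∈ 𝒟_C with Δ(s,s') = Γ(C) and S := { x ∈ 𝒳_C : Δ(s,x) < Γ(C) }. Then the probability flow out of S satisfies lim_{ν→∞} log Q(S,S^c) / log ν = 1 − Γ(C), where Q(S,S^c) := Σ_{x ∈ S, y ∈ S^c} π_C(x) q(x,y). -/

import Mathlib

open scoped Classical

noncomputable section

namespace CSMA

/-- An activity state of a multi-channel CSMA network with `N` nodes and `C` channels:
node `i` is inactive if `x i = 0` and active on channel `c` if `x i = c` (`1 ≤ c ≤ C`). -/
abbrev CState (N C : ℕ) := Fin N → Fin (C + 1)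

/-- Feasibility of an activity state: for every channel `c` and every edge of the conflict
graph `E c`, the two endpoints are not both active on channel `c`. -/
def Feasible {N C : ℕ} (E : Fin C → SimpleGraph (Fin N)) (x : CState N C) : Prop :=
  ∀ c : Fin C, ∀ i j : Fin N, (E c).Adj i j → ¬(x i = c.succ ∧ x j = c.succ)

/-- `a(x)`: the number of active nodes in state `x`. -/
def activeCount {N C : ℕ} (x : CState N C) : ℕ :=
  (Finset.univ.filter fun i => x i ≠ 0).card

/-- The finite set `𝒳_C` of feasible activity states. -/
def FeasibleSet {N C : ℕ} (E : Fin C → SimpleGraph (Fin N)) : Finset (CState N C) :=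
  Finset.univ.filter fun x => Feasible E x

/-- `𝒜(C)`: the maximum number of simultaneously active nodes over feasible states. -/
def maxActive {N C : ℕ} (E : Fin C → SimpleGraph (Fin N)) : ℕ :=
  (FeasibleSet E).sup activeCount

/-- `𝒟_C`: the set of dominant states, i.e. feasible states with `𝒜(C)` active nodes. -/
def DominantSet {N C : ℕ} (E : Fin C → SimpleGraph (Fin N)) : Finset (CState N C) :=
  (FeasibleSet E).filter fun x => activeCount x = maxActive E

/-- A single CSMA step: both states are feasible and `y` is obtained from `x` by either
the activation of a single inactive node on some channel, or the deactivation of a single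
active node (a node cannot change channel in a single step). -/
def Step {N C : ℕ} (E : Fin C → SimpleGraph (Fin N)) (x y : CState N C) : Prop :=
  Feasible E x ∧ Feasible E y ∧
    ∃ i : Fin N, (∀ j : Fin N, j ≠ i → y j = x j) ∧
      ((x i = 0 ∧ y i ≠ 0) ∨ (x i ≠ 0 ∧ y i = 0))

/-- `ω` is a path of CSMA steps from `x` to `y` inside the feasible state space. -/
def IsPath {N C : ℕ} (E : Fin C → SimpleGraph (Fin N)) (x y : CState N C)
    (ω : List (CState N C)) : Prop :=
  ω.head? = some x ∧ ω.getLast? = some y ∧ (∀ z ∈ ω, Feasible E z) ∧ ω.Chain' (Step E)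

/-- The height of a path: `max_{z ∈ ω} (𝒜(C) − a(z))`. -/
def pathHeight {N C : ℕ} (E : Fin C → SimpleGraph (Fin N)) (ω : List (CState N C)) : ℕ :=
  (ω.map fun z => maxActive E - activeCount z).foldr max 0

/-- The communication height `Δ(x,y) = min_{ω : x → y} max_{z ∈ ω} (𝒜(C) − a(z))`. -/
def commHeight {N C : ℕ} (E : Fin C → SimpleGraph (Fin N)) (x y : CState N C) : ℕ :=
  sInf {h : ℕ | ∃ ω, IsPath E x y ω ∧ pathHeight E ω = h}

/-- The communication height `Δ(x,D)` between a state and a set of states. -/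
def commHeightSet {N C : ℕ} (E : Fin C → SimpleGraph (Fin N)) (x : CState N C)
    (D : Set (CState N C)) : ℕ :=
  sInf {h : ℕ | ∃ ω y, y ∈ D ∧ IsPath E x y ω ∧ pathHeight E ω = h}

/-- `Γ(C)`: the worst communication height between a pair of dominant states. -/
def Gamma {N C : ℕ} (E : Fin C → SimpleGraph (Fin N)) : ℕ :=
  (DominantSet E).sup fun s => (DominantSet E).sup fun s' => commHeight E s s'

/-- The normalizing constant `Z(ν)` in the homogeneous case. -/
def Zhom {N C : ℕ} (E : Fin C → SimpleGraph (Fin N)) (ν : ℝ) : ℝ :=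
  ∑ y ∈ FeasibleSet E, ν ^ activeCount y

/-- The homogeneous stationary distribution `π_C(x) = ν^{a(x)} / Z(ν)`. -/
def piHom {N C : ℕ} (E : Fin C → SimpleGraph (Fin N)) (ν : ℝ) (x : CState N C) : ℝ :=
  ν ^ activeCount x / Zhom E ν


/-- The trap `S = { x ∈ 𝒳_C : Δ(s,x) < Γ(C) }` associated with a dominant state `s`. -/
def trapSet {N C : ℕ} (E : Fin C → SimpleGraph (Fin N)) (s : CState N C) :
    Finset (CState N C) :=
  (FeasibleSet E).filter fun x => commHeight E s x < Gamma E

/-- The homogeneous transition rates: `q(x,y) = ν` for an activation step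
(`y = x + c·e_i ∈ 𝒳_C`), `q(x,y) = 1` for a deactivation step (`y = x − c·e_i ∈ 𝒳_C`),
and `q(x,y) = 0` otherwise. -/
def qHom {N C : ℕ} (E : Fin C → SimpleGraph (Fin N)) (ν : ℝ) (x y : CState N C) : ℝ :=
  if Feasible E x ∧ Feasible E y ∧
      ∃ i : Fin N, (∀ j : Fin N, j ≠ i → y j = x j) ∧ x i = 0 ∧ y i ≠ 0 then ν
  else if Feasible E x ∧ Feasible E y ∧
      ∃ i : Fin N, (∀ j : Fin N, j ≠ i → y j = x j) ∧ x i ≠ 0 ∧ y i = 0 then 1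
  else 0

/-- The stationary probability flow out of the trap `S`:
`Q(S,Sᶜ) = Σ_{x ∈ S, y ∈ Sᶜ} π_C(x) q(x,y)` (with `Sᶜ = 𝒳_C \ S`). -/
def flowOut {N C : ℕ} (E : Fin C → SimpleGraph (Fin N)) (ν : ℝ) (s : CState N C) : ℝ :=
  ∑ x ∈ trapSet E s, ∑ y ∈ FeasibleSet E \ trapSet E s, piHom E ν x * qHom E ν x y

/-- `B(S)`: the number of pairs `(x,y) ∈ S × Sᶜ` such that `y` is one CSMA step from `x`;
it does not depend on `ν`. -/
def boundaryCount {N C : ℕ} (E : Fin C → SimpleGraph (Fin N)) (s : CState N C) : ℕ :=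
  ((trapSet E s ×ˢ (FeasibleSet E \ trapSet E s)).filter fun p => Step E p.1 p.2).card

section Paths

variable {N C : ℕ} {E : Fin C → SimpleGraph (Fin N)}

lemma mem_feasibleSet {x : CState N C} : x ∈ FeasibleSet E ↔ Feasible E x := by
  simp [FeasibleSet]

lemma activeCount_le_maxActive {x : CState N C} (hx : Feasible E x) :
    activeCount x ≤ maxActive E :=
  Finset.le_sup (f := activeCount) (mem_feasibleSet.2 hx)

lemma Step.symm {x y : CState N C} (h : Step E x y) : Step E y x := by
  obtain ⟨hx, hy, i, hi, hxy⟩ := h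
  exact ⟨hy, hx, i, fun j hj => (hi j hj).symm, by tauto⟩

/-- Activating a single node increases the number of active nodes by one. -/
lemma activeCount_of_activation {x y : CState N C} {i : Fin N}
    (hi : ∀ j, j ≠ i → y j = x j) (hx : x i = 0) (hy : y i ≠ 0) :
    activeCount y = activeCount x + 1 := by
  have h : (Finset.univ.filter fun j => y j ≠ 0) =
      insert i (Finset.univ.filter fun j => x j ≠ 0) := by
    ext j
    by_cases hj : j = i
    · subst hj; simp [hy]
    · simp [hj, hi j hj]
  unfold activeCount
  rw [h, Finset.card_insert_of_notMem (by simp [hx])]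

lemma Step.activeCount_eq {x y : CState N C} (h : Step E x y) :
    activeCount y = activeCount x + 1 ∨ activeCount x = activeCount y + 1 := by
  obtain ⟨-, -, i, hi, ⟨h0, h1⟩ | ⟨h0, h1⟩⟩ := h
  · exact Or.inl (activeCount_of_activation hi h0 h1)
  · exact Or.inr (activeCount_of_activation (fun j hj => (hi j hj).symm) h1 h0)

lemma reflTransGen_zero {x : CState N C} (hx : Feasible E x) :
    Relation.ReflTransGen (Step E) x 0 := by
  induction hn : activeCount x generalizing x with
  | zero =>
    have : x = 0 := by
      funext i
      simpa [activeCount, Finset.filter_eq_empty_iff] using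
        Finset.filter_eq_empty_iff.1 (Finset.card_eq_zero.1 hn) (Finset.mem_univ i)
    rw [this]
  | succ n ih =>
    obtain ⟨i, hi⟩ := Finset.card_pos.1 (hn ▸ n.succ_pos : 0 < activeCount x)
    have hi : x i ≠ 0 := by simpa using hi
    have hy : Feasible E (Function.update x i 0) := by
      intro c j k hjk ⟨h1, h2⟩
      have aux : ∀ l, Function.update x i 0 l = c.succ → x l = c.succ := by
        intro l hl
        by_cases h : l = i
        · subst h; simp [eq_comm] at hl
        · simpa [h] using hl
      exact hx c j k hjk ⟨aux j h1, aux k h2⟩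
    have hstep : Step E x (Function.update x i 0) :=
      ⟨hx, hy, i, fun j hj => by simp [hj], Or.inr ⟨hi, by simp⟩⟩
    have hcount : activeCount x = activeCount (Function.update x i 0) + 1 :=
      activeCount_of_activation (i := i) (fun j hj => by simp [hj]) (by simp) hi
    exact .head hstep (ih hy (by omega))

lemma reflTransGen_step {x y : CState N C} (hx : Feasible E x) (hy : Feasible E y) :
    Relation.ReflTransGen (Step E) x y :=
  (reflTransGen_zero hx).trans
    (Relation.ReflTransGen.mono (fun _ _ h => Step.symm h) _ _ (reflTransGen_zero hy).swap)

lemma le_pathHeight {ω : List (CState N C)} {z : CState N C} (hz : z ∈ ω) :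
    maxActive E - activeCount z ≤ pathHeight E ω := by
  induction ω with
  | nil => simp at hz
  | cons w ω ih =>
    rcases List.mem_cons.1 hz with rfl | h
    · simp [pathHeight]
    · exact (ih h).trans (by simp [pathHeight])

lemma pathHeight_concat (ω : List (CState N C)) (z : CState N C) :
    pathHeight E (ω ++ [z]) = max (pathHeight E ω) (maxActive E - activeCount z) := by
  induction ω with
  | nil => simp [pathHeight]
  | cons w ω ih =>
    simp only [pathHeight, List.cons_append, List.map_cons, List.foldr_cons] at ih ⊢
    rw [ih, max_assoc]

lemma isPath_singleton {x : CState N C} (hx : Feasible E x) : IsPath E x x [x] :=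
  ⟨by simp, by simp, by simpa using hx, List.isChain_singleton x⟩

lemma IsPath.concat {x y z : CState N C} {ω : List (CState N C)} (hω : IsPath E x y ω)
    (h : Step E y z) : IsPath E x z (ω ++ [z]) := by
  obtain ⟨h1, h2, h3, h4⟩ := hω
  refine ⟨by simp [h1], by simp, ?_, ?_⟩
  · intro w hw
    rcases List.mem_append.1 hw with hw | hw
    · exact h3 w hw
    · rw [List.mem_singleton.1 hw]; exact h.2.1
  · refine List.isChain_append.2 ⟨h4, by simp, ?_⟩
    intro u hu v hv
    simp_all

lemma exists_isPath {x y : CState N C} (hx : Feasible E x) (hy : Feasible E y) :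
    ∃ ω, IsPath E x y ω := by
  have h := reflTransGen_step hx hy
  clear hy
  induction h with
  | refl => exact ⟨_, isPath_singleton hx⟩
  | tail _ h ih => exact ih.imp' (· ++ [_]) fun _ hω => hω.concat h

lemma exists_isPath_pathHeight_eq {x y : CState N C} (hx : Feasible E x)
    (hy : Feasible E y) : ∃ ω, IsPath E x y ω ∧ pathHeight E ω = commHeight E x y :=
  Nat.sInf_mem (s := {h | ∃ ω, IsPath E x y ω ∧ pathHeight E ω = h})
    ((exists_isPath hx hy).imp' _ fun ω hω => ⟨ω, hω, rfl⟩)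

lemma IsPath.commHeight_le {x y : CState N C} {ω : List (CState N C)}
    (hω : IsPath E x y ω) : commHeight E x y ≤ pathHeight E ω :=
  Nat.sInf_le ⟨ω, hω, rfl⟩

lemma sub_activeCount_le_commHeight {x y : CState N C} (hx : Feasible E x)
    (hy : Feasible E y) : maxActive E - activeCount y ≤ commHeight E x y := by
  obtain ⟨ω, hω, h⟩ := exists_isPath_pathHeight_eq hx hy
  exact h ▸ le_pathHeight (List.mem_of_getLast? hω.2.1)

lemma commHeight_le_of_step {x y z : CState N C} (hx : Feasible E x) (h : Step E y z) :
    commHeight E x z ≤ max (commHeight E x y) (maxActive E - activeCount z) := by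
  obtain ⟨ω, hω, h'⟩ := exists_isPath_pathHeight_eq hx h.1
  rw [← h', ← pathHeight_concat]
  exact (hω.concat h).commHeight_le

lemma mem_dominantSet {x : CState N C} :
    x ∈ DominantSet E ↔ Feasible E x ∧ activeCount x = maxActive E := by
  simp [DominantSet, mem_feasibleSet]

lemma commHeight_pos {x y : CState N C} (hx : x ∈ DominantSet E) (hy : y ∈ DominantSet E)
    (hxy : x ≠ y) : 0 < commHeight E x y := by
  obtain ⟨hx, hax⟩ := mem_dominantSet.1 hx
  obtain ⟨ω, hω, h⟩ := exists_isPath_pathHeight_eq hx (mem_dominantSet.1 hy).1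
  obtain ⟨h1, h2, -, h4⟩ := hω
  rw [← h]
  match ω, h1, h2, h4 with
  | [a], h1, h2, _ => simp_all
  | a :: b :: l, h1, _, h4 =>
    have hstep : Step E x b := by
      have hax : a = x := by simpa using h1
      exact hax ▸ (List.isChain_cons_cons.1 h4).1
    have hb := activeCount_le_maxActive hstep.2.1
    have hle : maxActive E - activeCount b ≤ pathHeight E (a :: b :: l) :=
      le_pathHeight (by simp)
    have := hstep.activeCount_eq
    omega

lemma Gamma_pos (hcard : 2 ≤ (DominantSet E).card) : 0 < Gamma E := by
  obtain ⟨u, hu, v, hv, huv⟩ := Finset.one_lt_card.1 hcard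
  refine (commHeight_pos hu hv huv).trans_le ?_
  exact (Finset.le_sup (f := fun v => commHeight E u v) hv).trans
    (Finset.le_sup (f := fun u => (DominantSet E).sup fun v => commHeight E u v) hu)

lemma commHeight_self {x : CState N C} (hx : x ∈ DominantSet E) :
    commHeight E x x = 0 := by
  obtain ⟨hx, hax⟩ := mem_dominantSet.1 hx
  simpa [pathHeight, hax] using (isPath_singleton hx).commHeight_le

lemma mem_trapSet {s x : CState N C} :
    x ∈ trapSet E s ↔ Feasible E x ∧ commHeight E s x < Gamma E := by
  simp [trapSet, mem_feasibleSet]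

/-- A step leaving the trap is a deactivation crossing the level `𝒜(C) − Γ(C)`. -/
lemma activeCount_of_step_out {s x y : CState N C} (hs : Feasible E s)
    (hx : x ∈ trapSet E s) (hy : y ∉ trapSet E s) (h : Step E x y) :
    activeCount x + Gamma E = maxActive E + 1 ∧ activeCount x = activeCount y + 1 := by
  have hx' := (mem_trapSet.1 hx).2
  have hy' : Gamma E ≤ commHeight E s y := by
    by_contra hlt
    exact hy (mem_trapSet.2 ⟨h.2.1, not_le.1 hlt⟩)
  have h1 := commHeight_le_of_step hs h
  have h2 := sub_activeCount_le_commHeight hs h.1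
  have h3 := activeCount_le_maxActive h.1
  have h4 := activeCount_le_maxActive h.2.1
  have h5 := h.activeCount_eq
  rcases le_max_iff.1 h1 with h1 | h1 <;> omega

lemma boundaryCount_pos {s s' : CState N C} (hs : s ∈ trapSet E s)
    (hs' : s' ∉ trapSet E s) (hf : Feasible E s') : 0 < boundaryCount E s := by
  have hsf := (mem_trapSet.1 hs).1
  by_contra hB
  have hnone : ∀ x y, x ∈ trapSet E s → Step E x y → y ∈ trapSet E s := by
    intro x y hx hxy
    by_contra hy
    refine hB (Finset.card_pos.2 ⟨(x, y), ?_⟩)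
    simp [hx, hy, hxy, mem_feasibleSet, hxy.2.1]
  refine hs' ?_
  have h := reflTransGen_step hsf hf
  clear hs' hf
  induction h with
  | refl => exact hs
  | tail _ h ih => exact hnone _ _ ih h

lemma qHom_eq_zero (ν : ℝ) {x y : CState N C} (h : ¬ Step E x y) : qHom E ν x y = 0 := by
  unfold qHom
  rw [if_neg, if_neg]
  · rintro ⟨hx, hy, i, hi, h0⟩
    exact h ⟨hx, hy, i, hi, Or.inr h0⟩
  · rintro ⟨hx, hy, i, hi, h0⟩
    exact h ⟨hx, hy, i, hi, Or.inl h0⟩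

lemma qHom_eq_one (ν : ℝ) {x y : CState N C} (h : Step E x y)
    (hxy : activeCount x = activeCount y + 1) : qHom E ν x y = 1 := by
  obtain ⟨hx, hy, i, hi, h0⟩ := h
  have hdown : ¬ ∃ i : Fin N, (∀ j : Fin N, j ≠ i → y j = x j) ∧ x i = 0 ∧ y i ≠ 0 := by
    rintro ⟨i, hi, h0, h1⟩
    have := activeCount_of_activation hi h0 h1
    omega
  unfold qHom
  rw [if_neg fun h => hdown h.2.2, if_pos]
  exact ⟨hx, hy, i, hi, h0.resolve_left fun h0 => hdown ⟨i, hi, h0⟩⟩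

lemma flowOut_eq {s : CState N C} (hs : Feasible E s) (ν : ℝ) :
    flowOut E ν s =
      boundaryCount E s * (ν ^ (maxActive E + 1 - Gamma E) / Zhom E ν) := by
  unfold flowOut boundaryCount
  rw [← Finset.sum_product', ← nsmul_eq_mul, ← Finset.sum_const, Finset.sum_filter]
  refine Finset.sum_congr rfl fun p hp => ?_
  obtain ⟨hx, hy⟩ := Finset.mem_product.1 hp
  split_ifs with h
  · obtain ⟨h1, h2⟩ := activeCount_of_step_out hs hx (Finset.mem_sdiff.1 hy).2 h
    rw [qHom_eq_one ν h h2, mul_one, piHom, ← h1, Nat.add_sub_cancel]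
  · rw [qHom_eq_zero ν h, mul_zero]

end Paths

section Asymptotics

variable {N C : ℕ} {E : Fin C → SimpleGraph (Fin N)}

lemma pow_maxActive_le_Zhom {s : CState N C} (hs : s ∈ DominantSet E) {ν : ℝ}
    (hν : 0 ≤ ν) : ν ^ maxActive E ≤ Zhom E ν := by
  obtain ⟨hf, ha⟩ := mem_dominantSet.1 hs
  rw [← ha]
  exact Finset.single_le_sum (f := fun y => ν ^ activeCount y)
    (fun _ _ => pow_nonneg hν _) (mem_feasibleSet.2 hf)

lemma Zhom_le {ν : ℝ} (hν : 1 ≤ ν) :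
    Zhom E ν ≤ (FeasibleSet E).card * ν ^ maxActive E := by
  rw [← nsmul_eq_mul]
  exact Finset.sum_le_card_nsmul _ _ _ fun y hy =>
    pow_le_pow_right₀ hν (activeCount_le_maxActive (mem_feasibleSet.1 hy))

lemma tendsto_log_Zhom_div_log {s : CState N C} (hs : s ∈ DominantSet E) :
    Filter.Tendsto (fun ν : ℝ => Real.log (Zhom E ν) / Real.log ν)
      Filter.atTop (nhds (maxActive E : ℝ)) := by
  have hM : (0 : ℝ) < (FeasibleSet E).card :=
    Nat.cast_pos.2 (Finset.card_pos.2 ⟨s, mem_feasibleSet.2 (mem_dominantSet.1 hs).1⟩)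
  have hupper : Filter.Tendsto
      (fun ν : ℝ => Real.log (FeasibleSet E).card / Real.log ν + maxActive E)
      Filter.atTop (nhds (maxActive E : ℝ)) := by
    simpa using (Real.tendsto_log_atTop.const_div_atTop
      (Real.log (FeasibleSet E).card)).add_const (maxActive E : ℝ)
  refine tendsto_of_tendsto_of_tendsto_of_le_of_le' tendsto_const_nhds hupper ?_ ?_
  · filter_upwards [Filter.eventually_gt_atTop 1] with ν hν
    have hν0 : 0 < ν := one_pos.trans hν
    rw [le_div_iff₀ (Real.log_pos hν), ← Real.log_pow]
    exact Real.log_le_log (by positivity) (pow_maxActive_le_Zhom hs hν0.le)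
  · filter_upwards [Filter.eventually_gt_atTop 1] with ν hν
    have hν0 : 0 < ν := one_pos.trans hν
    have hlog := Real.log_pos hν
    have hZ : 0 < Zhom E ν := (pow_pos hν0 _).trans_le (pow_maxActive_le_Zhom hs hν0.le)
    rw [div_add' _ _ _ hlog.ne', ← Real.log_pow, ← Real.log_mul hM.ne' (by positivity)]
    gcongr
    exact Zhom_le hν.le

end Asymptotics

/-- Let `s, s' ∈ 𝒟_C` with `Δ(s,s') = Γ(C)` and
`S = { x ∈ 𝒳_C : Δ(s,x) < Γ(C) }`. Then the probability flow out of `S` satisfies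
`lim_{ν→∞} log Q(S,Sᶜ) / log ν = 1 − Γ(C)`. -/
theorem flowOut_log_asymptotics (N C : ℕ) (hC : 1 ≤ C)
    (E : Fin C → SimpleGraph (Fin N)) (hcard : 2 ≤ (DominantSet E).card)
    (s s' : CState N C) (hs : s ∈ DominantSet E) (hs' : s' ∈ DominantSet E)
    (hΓ : commHeight E s s' = Gamma E) :
    Filter.Tendsto (fun ν : ℝ => Real.log (flowOut E ν s) / Real.log ν)
      Filter.atTop (nhds (1 - (Gamma E : ℝ))) := by
  have hsf := (mem_dominantSet.1 hs).1
  have hsS : s ∈ trapSet E s :=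
    mem_trapSet.2 ⟨hsf, by rw [commHeight_self hs]; exact Gamma_pos hcard⟩
  have hs'S : s' ∉ trapSet E s := fun h => (mem_trapSet.1 h).2.ne hΓ
  have hB := boundaryCount_pos hsS hs'S (mem_dominantSet.1 hs').1
  have hΓle : Gamma E ≤ maxActive E + 1 := by
    obtain ⟨p, hp⟩ := Finset.card_pos.1 hB
    obtain ⟨hp, hstep⟩ := Finset.mem_filter.1 hp
    obtain ⟨hx, hy⟩ := Finset.mem_product.1 hp
    have := activeCount_of_step_out hsf hx (Finset.mem_sdiff.1 hy).2 hstep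
    omega
  have hlim : Filter.Tendsto (fun ν : ℝ => Real.log (boundaryCount E s) / Real.log ν +
      ((maxActive E + 1 - Gamma E : ℕ) : ℝ) - Real.log (Zhom E ν) / Real.log ν)
      Filter.atTop (nhds (1 - (Gamma E : ℝ))) := by
    convert ((Real.tendsto_log_atTop.const_div_atTop
      (Real.log (boundaryCount E s))).add_const
        ((maxActive E + 1 - Gamma E : ℕ) : ℝ)).sub (tendsto_log_Zhom_div_log hs) using 2
    push_cast [Nat.cast_sub hΓle]
    ring
  refine hlim.congr' ?_
  filter_upwards [Filter.eventually_gt_atTop 1] with ν hν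
  have hν0 : 0 < ν := one_pos.trans hν
  have hZ : 0 < Zhom E ν := (pow_pos hν0 _).trans_le (pow_maxActive_le_Zhom hs hν0.le)
  have hB' : (0 : ℝ) < boundaryCount E s := Nat.cast_pos.2 hB
  have hlog := Real.log_pos hν
  rw [flowOut_eq hsf, Real.log_mul hB'.ne' (by positivity),
    Real.log_div (by positivity) hZ.ne', Real.log_pow]
  field_simp
  ring

end CSMA
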